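/- (Correctness of the node-level SIMD DTW lower bound.) Let w, m ≥ 1, n = w·m, let q, c : Fin n → ℝ be series, r : ℕ a warping reach, U, L the LB_Keogh envelope of q with reach r, and let l, u : Fin w → ℝ with l s ≤ u s and l s ≤ PAA(c) s ≤ u s for every segment s (c is contained in the iSAX node with segment intervals [l s, u s]). For each segment s define e_s = max(l s − PAA(U) s, PAA(L) s − u s, 0) (the ABOVE distance if the candidate's box lies above the envelope PAA, the BELOW distance if it lies below, and 0 if it intersects the envelope). Then sqrt(Σ_s m · e_s²) ≤ LB_Keogh_r(q,c) ≤ DTW_r(q,c): the three-case per-segment distance between the query envelope PAA representation and the node's iSAX segment intervals lower bounds the constrained DTW distance between the query and every series contained in the node. -/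

import Mathlib

def bandSet (n r : ℕ) (i : Fin n) : Finset (Fin n) :=
  Finset.univ.filter (fun j => |((i : ℕ) : ℤ) - ((j : ℕ) : ℤ)| ≤ (r : ℤ))

lemma bandSet_nonempty (n r : ℕ) (i : Fin n) : (bandSet n r i).Nonempty :=
  ⟨i, by simp [bandSet]⟩

/-- Upper LB_Keogh envelope of `q` with reach `r`. -/
noncomputable def envU {n : ℕ} (q : Fin n → ℝ) (r : ℕ) : Fin n → ℝ :=
  fun i => (bandSet n r i).sup' (bandSet_nonempty n r i) q

/-- Lower LB_Keogh envelope of `q` with reach `r`. -/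
noncomputable def envL {n : ℕ} (q : Fin n → ℝ) (r : ℕ) : Fin n → ℝ :=
  fun i => (bandSet n r i).inf' (bandSet_nonempty n r i) q

/-- The LB_Keogh lower-bounding measure of candidate `c` w.r.t. the envelope of `q` with reach `r`. -/
noncomputable def LBKeogh {n : ℕ} (q c : Fin n → ℝ) (r : ℕ) : ℝ :=
  Real.sqrt (∑ i, if envU q r i < c i then (c i - envU q r i) ^ 2
    else if c i < envL q r i then (c i - envL q r i) ^ 2 else 0)

/-- The PAA representation: the vector of the `w` segment means of a series of length `w * m`. -/
noncomputable def PAA (w m : ℕ) (q : Fin (w * m) → ℝ) : Fin w → ℝ :=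
  fun s => (1 / (m : ℝ)) * ∑ t : Fin m, q ⟨(s : ℕ) * m + (t : ℕ), by
    calc (s : ℕ) * m + (t : ℕ) < (s : ℕ) * m + m := Nat.add_lt_add_left t.isLt _
      _ = ((s : ℕ) + 1) * m := by ring
      _ ≤ w * m := Nat.mul_le_mul s.isLt (le_refl m)⟩

/-- A constrained warping path between two series of length `n`, with band reach `r`. -/
structure WarpingPath (n r : ℕ) where
  K : ℕ
  p : Fin (K + 1) → ℕ × ℕ
  mem1 : ∀ k, (p k).1 < n
  mem2 : ∀ k, (p k).2 < n
  start : p 0 = (0, 0)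
  finish : p (Fin.last K) = (n - 1, n - 1)
  step : ∀ k : Fin K,
    p k.succ = ((p k.castSucc).1 + 1, (p k.castSucc).2) ∨
    p k.succ = ((p k.castSucc).1, (p k.castSucc).2 + 1) ∨
    p k.succ = ((p k.castSucc).1 + 1, (p k.castSucc).2 + 1)
  band : ∀ k, |(((p k).1 : ℤ)) - (((p k).2 : ℤ))| ≤ (r : ℤ)

/-- The cost of a warping path. -/
noncomputable def dtwCost {n r : ℕ} (q c : Fin n → ℝ) (P : WarpingPath n r) : ℝ :=
  Real.sqrt (∑ k : Fin (P.K + 1),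
    (q ⟨(P.p k).1, P.mem1 k⟩ - c ⟨(P.p k).2, P.mem2 k⟩) ^ 2)

/-- The constrained DTW distance with reach `r`: minimal cost over all warping paths. -/
noncomputable def DTW (n r : ℕ) (q c : Fin n → ℝ) : ℝ :=
  sInf { x : ℝ | ∃ P : WarpingPath n r, x = dtwCost q c P }

noncomputable def gap {n : ℕ} (q c : Fin n → ℝ) (r : ℕ) (i : Fin n) : ℝ :=
  max (c i - envU q r i) (max (envL q r i - c i) 0)

lemma le_envU {n : ℕ} (q : Fin n → ℝ) (r : ℕ) (i j : Fin n) (h : j ∈ bandSet n r i) :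
    q j ≤ envU q r i := Finset.le_sup' q h

lemma envL_le {n : ℕ} (q : Fin n → ℝ) (r : ℕ) (i j : Fin n) (h : j ∈ bandSet n r i) :
    envL q r i ≤ q j := Finset.inf'_le q h

lemma self_mem_band (n r : ℕ) (i : Fin n) : i ∈ bandSet n r i := by simp [bandSet]

lemma LBKeogh_eq {n : ℕ} (q c : Fin n → ℝ) (r : ℕ) :
    LBKeogh q c r = Real.sqrt (∑ i, gap q c r i ^ 2) := by
  unfold LBKeogh
  congr 1
  refine Finset.sum_congr rfl fun i _ => ?_
  have h1 := le_envU q r i i (self_mem_band n r i)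
  have h2 := envL_le q r i i (self_mem_band n r i)
  unfold gap
  split_ifs with ha hb
  · rw [max_eq_left]
    exact max_le (by linarith) (by linarith)
  · rw [max_eq_right, max_eq_left]
    · ring
    · linarith
    · exact le_max_of_le_left (by linarith)
  · push Not at ha hb
    rw [max_eq_right, max_eq_right]
    · norm_num
    · linarith
    · exact le_max_of_le_right (by linarith)

lemma gap_nonneg {n : ℕ} (q c : Fin n → ℝ) (r : ℕ) (i : Fin n) : 0 ≤ gap q c r i :=
  le_max_of_le_right (le_max_right _ _)

lemma gap_le {n : ℕ} (q c : Fin n → ℝ) (r : ℕ) (i j : Fin n) (h : j ∈ bandSet n r i) :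
    gap q c r i ^ 2 ≤ (q j - c i) ^ 2 := by
  have h1 := le_envU q r i j h
  have h2 := envL_le q r i j h
  rw [← sq_abs (q j - c i)]
  refine pow_le_pow_left₀ (gap_nonneg q c r i) ?_ 2
  have h3 := le_abs_self (q j - c i)
  have h4 := neg_abs_le (q j - c i)
  exact max_le (by linarith) (max_le (by linarith) (abs_nonneg _))

lemma path_hits {n r : ℕ} (P : WarpingPath n r) (k : Fin (P.K + 1)) :
    ∀ j ≤ (P.p k).2, ∃ k', (P.p k').2 = j := by
  induction k using Fin.induction with
  | zero =>
    intro j hj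
    exact ⟨0, by rw [P.start] at hj ⊢; simp at hj ⊢; omega⟩
  | succ k ih =>
    intro j hj
    by_cases h : j ≤ (P.p k.castSucc).2
    · exact ih j h
    · refine ⟨k.succ, ?_⟩
      rcases P.step k with hs | hs | hs <;> rw [hs] at hj ⊢ <;> simp only at hj ⊢ <;> omega

lemma LBKeogh_le_cost {n r : ℕ} (q c : Fin n → ℝ) (P : WarpingPath n r) :
    LBKeogh q c r ≤ dtwCost q c P := by
  rw [LBKeogh_eq]
  unfold dtwCost
  apply Real.sqrt_le_sqrt
  have hit : ∀ j : Fin n, ∃ k, (P.p k).2 = j := by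
    intro j
    apply path_hits P (Fin.last _)
    rw [P.finish]
    have := j.isLt
    simp only
    omega
  choose f hf using hit
  have finj : Function.Injective f := by
    intro a b hab
    apply Fin.ext
    rw [← hf a, ← hf b, hab]
  calc ∑ i, gap q c r i ^ 2
      ≤ ∑ i, (q ⟨(P.p (f i)).1, P.mem1 (f i)⟩ - c ⟨(P.p (f i)).2, P.mem2 (f i)⟩) ^ 2 := by
        refine Finset.sum_le_sum fun i _ => ?_
        have hi : (⟨(P.p (f i)).2, P.mem2 (f i)⟩ : Fin n) = i := Fin.ext (hf i)
        rw [hi]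
        apply gap_le
        have := P.band (f i)
        rw [hf i, abs_sub_comm] at this
        simpa [bandSet] using this
    _ = ∑ k ∈ Finset.univ.image f,
          (q ⟨(P.p k).1, P.mem1 k⟩ - c ⟨(P.p k).2, P.mem2 k⟩) ^ 2 := by
        rw [Finset.sum_image (fun a _ b _ h => finj h)]
    _ ≤ _ := Finset.sum_le_sum_of_subset_of_nonneg (Finset.subset_univ _)
        (fun _ _ _ => sq_nonneg _)

def diagPath (n r : ℕ) (hn : 1 ≤ n) : WarpingPath n r where
  K := n - 1
  p := fun k => (k, k)
  mem1 := fun k => by have := k.isLt; simp only; omega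
  mem2 := fun k => by have := k.isLt; simp only; omega
  start := by simp
  finish := by simp
  step := fun k => by simp
  band := fun k => by simp

lemma seg_lt {w m : ℕ} (s : Fin w) (t : Fin m) : (s : ℕ) * m + (t : ℕ) < w * m := by
  calc (s : ℕ) * m + (t : ℕ) < (s : ℕ) * m + m := Nat.add_lt_add_left t.isLt _
      _ = ((s : ℕ) + 1) * m := by ring
      _ ≤ w * m := Nat.mul_le_mul s.isLt (le_refl m)

lemma sum_seg (w m : ℕ) (f : Fin (w * m) → ℝ) :
    ∑ i, f i = ∑ s : Fin w, ∑ t : Fin m, f ⟨(s : ℕ) * m + (t : ℕ), seg_lt s t⟩ := by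
  rw [← Fintype.sum_prod_type', ← Equiv.sum_comp finProdFinEquiv]
  refine Finset.sum_congr rfl fun x _ => ?_
  congr 1
  apply Fin.ext
  simp [finProdFinEquiv]
  ring

lemma PAA_sub (w m : ℕ) (f g : Fin (w * m) → ℝ) (s : Fin w) :
    PAA w m f s - PAA w m g s = PAA w m (fun i => f i - g i) s := by
  simp only [PAA, Finset.sum_sub_distrib]
  ring

lemma PAA_mono (w m : ℕ) (f g : Fin (w * m) → ℝ) (h : ∀ i, f i ≤ g i) (s : Fin w) :
    PAA w m f s ≤ PAA w m g s := by
  unfold PAA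
  exact mul_le_mul_of_nonneg_left (Finset.sum_le_sum fun _ _ => h _) (by positivity)

lemma PAA_sq (w m : ℕ) (hm : 1 ≤ m) (f : Fin (w * m) → ℝ) (s : Fin w) :
    (m : ℝ) * PAA w m f s ^ 2 ≤ ∑ t : Fin m, f ⟨(s : ℕ) * m + (t : ℕ), seg_lt s t⟩ ^ 2 := by
  have h := sq_sum_le_card_mul_sum_sq (s := (Finset.univ : Finset (Fin m)))
    (f := fun t => f ⟨(s : ℕ) * m + (t : ℕ), seg_lt s t⟩)
  have hm' : (0 : ℝ) < m := by exact_mod_cast hm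
  simp only [Finset.card_univ, Fintype.card_fin] at h
  unfold PAA
  rw [mul_pow, ← mul_assoc]
  have : (m : ℝ) * (1 / (m : ℝ)) ^ 2 = 1 / m := by field_simp
  rw [this, one_div, inv_mul_le_iff₀ hm']
  exact h

theorem stmt15 (w m : ℕ) (hw : 1 ≤ w) (hm : 1 ≤ m) (q c : Fin (w * m) → ℝ) (r : ℕ)
    (l u : Fin w → ℝ) (hlu : ∀ s, l s ≤ u s)
    (hc : ∀ s, l s ≤ PAA w m c s ∧ PAA w m c s ≤ u s)
    (e : Fin w → ℝ)
    (he : ∀ s, e s = max (l s - PAA w m (envU q r) s) (max (PAA w m (envL q r) s - u s) 0)) :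
    Real.sqrt (∑ s : Fin w, (m : ℝ) * e s ^ 2) ≤ LBKeogh q c r ∧
    LBKeogh q c r ≤ DTW (w * m) r q c := by
  constructor
  · rw [LBKeogh_eq]
    apply Real.sqrt_le_sqrt
    rw [sum_seg]
    refine Finset.sum_le_sum fun s _ => ?_
    refine le_trans ?_ (PAA_sq w m hm (gap q c r) s)
    have h1 := PAA_mono w m (fun i => c i - envU q r i) (gap q c r) (fun i => le_max_left _ _) s
    have h2 := PAA_mono w m (fun i => envL q r i - c i) (gap q c r)
      (fun i => le_max_of_le_right (le_max_left _ _)) s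
    have h3 := PAA_mono w m (fun _ => 0) (gap q c r) (gap_nonneg q c r) s
    have h0 : PAA w m (fun _ => 0) s = 0 := by simp [PAA]
    rw [← PAA_sub] at h1 h2
    rw [h0] at h3
    obtain ⟨hc1, hc2⟩ := hc s
    have hle : e s ≤ PAA w m (gap q c r) s := by
      rw [he]
      exact max_le (by linarith) (max_le (by linarith) h3)
    have hnn : 0 ≤ e s := by
      rw [he]
      exact le_max_of_le_right (le_max_right _ _)
    exact mul_le_mul_of_nonneg_left (pow_le_pow_left₀ hnn hle 2) (by positivity)
  · unfold DTW
    apply le_csInf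
    · exact ⟨_, diagPath (w * m) r (Nat.mul_pos hw hm), rfl⟩
    · rintro x ⟨P, rfl⟩
      exact LBKeogh_le_cost q c P
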